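/- arXiv:1911.00266 — 5 statements merged into one kernel-verified Lean document; each statement's English description precedes it below -/
import Mathlib

section
/- Let θ = nπ/m where n is odd, n and m are coprime positive integers with n < m. Then for all integers M and M': sin((M+3/2)θ)·sin(M'θ) − sin((M+1/2)θ)·sin((M'+1)θ) = −sin θ · sin((M−M'+1/2)θ), and this quantity is never zero. Consequently the two sequences of allowed boundary values p = 1 + sin((M'+1)θ)/sin(M'θ) and p = 1 + sin((M+3/2)θ)/sin((M+1/2)θ) are disjoint. -/
theorem sin_add_mul_sin_sub_sin_mul_sin_add (a b θ : ℝ) :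
    Real.sin (a + θ) * Real.sin b - Real.sin a * Real.sin (b + θ) =
      -(Real.sin θ * Real.sin (a - b)) := by
  rw [Real.sin_add, Real.sin_add, Real.sin_sub]
  ring

theorem sin_half_odd_mul_ne_zero {n m : ℕ} (hno : Odd n) (hm : m ≠ 0) (k : ℤ) :
    Real.sin (((k : ℝ) + 1/2) * (n * Real.pi / m)) ≠ 0 := by
  rw [Real.sin_ne_zero_iff]
  intro j hj
  have hm' : (m : ℝ) ≠ 0 := by exact_mod_cast hm
  have hreal : ((2 * k + 1) * n : ℝ) = 2 * (m * j) := by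
    field_simp at hj
    linarith
  have hint : (2 * k + 1) * (n : ℤ) = 2 * (m * j) := by exact_mod_cast hreal
  have hodd : Odd ((2 * k + 1) * (n : ℤ)) :=
    (odd_two_mul_add_one k).mul (by exact_mod_cast hno)
  rw [hint] at hodd
  exact Int.not_odd_iff_even.mpr (even_two_mul _) hodd

theorem sin_natCast_mul_pi_div_pos {n m : ℕ} (hn : 0 < n) (hnm : n < m) :
    0 < Real.sin (n * Real.pi / m) := by
  have hn' : (0 : ℝ) < n := by exact_mod_cast hn
  have hnm' : (n : ℝ) < m := by exact_mod_cast hnm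
  have hm' : (0 : ℝ) < m := hn'.trans hnm'
  apply Real.sin_pos_of_pos_of_lt_pi
  · positivity
  · rw [div_lt_iff₀ hm', mul_comm Real.pi]
    exact mul_lt_mul_of_pos_right hnm' Real.pi_pos


/-- Case 1 (n odd): for θ = nπ/m with n, m coprime, n < m,
sin((M+3/2)θ)sin(M'θ) − sin((M+1/2)θ)sin((M'+1)θ) = −sin θ · sin((M−M'+1/2)θ) ≠ 0;
consequently the two sequences of allowed boundary values
p = 1 + sin((M'+1)θ)/sin(M'θ) and p = 1 + sin((M+3/2)θ)/sin((M+1/2)θ) are disjoint. -/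
theorem potts_case1_sequences_disjoint (n m : ℕ) (hcop : Nat.Coprime n m)
    (hno : Odd n) (hnm : n < m) (θ : ℝ) (hθ : θ = n * Real.pi / m) (M M' : ℤ) :
    (Real.sin (((M : ℝ) + 3/2) * θ) * Real.sin (M' * θ) -
        Real.sin (((M : ℝ) + 1/2) * θ) * Real.sin ((M' + 1) * θ) =
      -(Real.sin θ * Real.sin (((M : ℝ) - (M' : ℝ) + 1/2) * θ))) ∧
    (Real.sin (((M : ℝ) + 3/2) * θ) * Real.sin (M' * θ) -
        Real.sin (((M : ℝ) + 1/2) * θ) * Real.sin ((M' + 1) * θ) ≠ 0) ∧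
    (1 + Real.sin ((M' + 1) * θ) / Real.sin (M' * θ) ≠
      1 + Real.sin (((M : ℝ) + 3/2) * θ) / Real.sin (((M : ℝ) + 1/2) * θ)) := by
  have hm : m ≠ 0 := by omega
  have half_ne_zero (k : ℤ) : Real.sin (((k : ℝ) + 1/2) * θ) ≠ 0 :=
    hθ ▸ sin_half_odd_mul_ne_zero hno hm k
  have hsin : Real.sin θ ≠ 0 := hθ ▸ (sin_natCast_mul_pi_div_pos hno.pos hnm).ne'
  have hid : Real.sin (((M : ℝ) + 3/2) * θ) * Real.sin (M' * θ) -
        Real.sin (((M : ℝ) + 1/2) * θ) * Real.sin ((M' + 1) * θ) =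
      -(Real.sin θ * Real.sin (((M : ℝ) - (M' : ℝ) + 1/2) * θ)) := by
    convert sin_add_mul_sin_sub_sin_mul_sin_add (((M : ℝ) + 1/2) * θ) (M' * θ) θ using 4 <;>
      ring_nf
  have hne : Real.sin (((M : ℝ) + 3/2) * θ) * Real.sin (M' * θ) -
        Real.sin (((M : ℝ) + 1/2) * θ) * Real.sin ((M' + 1) * θ) ≠ 0 := by
    rw [hid]
    exact neg_ne_zero.mpr (mul_ne_zero hsin (by exact_mod_cast half_ne_zero (M - M')))
  refine ⟨hid, hne, fun h => ?_⟩
  have hratio := add_left_cancel h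
  have hM := half_ne_zero M
  by_cases hM' : Real.sin (M' * θ) = 0
  · have hsucc : Real.sin (((M : ℝ) + 3/2) * θ) ≠ 0 := by
      convert half_ne_zero (M + 1) using 3
      push_cast
      ring
    rw [hM', div_zero] at hratio
    exact div_ne_zero hsucc hM hratio.symm
  · rw [div_eq_div_iff hM' hM] at hratio
    exact hne (by linarith)
end

section
/- Let θ = nπ/m where n is odd, n and m are coprime positive integers with n < m. If m is odd, then for M = (m−1)/2 one has sin(Mθ) ≠ 0 and sin((M+1)θ) = sin(Mθ), so that 1 + sin((M+1)θ)/sin(Mθ) = 2. If m is even, then for M = m/2 − 1 one has sin((M+1/2)θ) ≠ 0 and sin((M+3/2)θ) = sin((M+1/2)θ), so that 1 + sin((M+3/2)θ)/sin((M+1/2)θ) = 2. Hence the boundary value p = 2 is allowed in Case 1. -/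
/-- Two angles placed symmetrically about an odd multiple of `π / 2`, at distance less than
`π / 2` from it, have the same nonzero sine. -/
theorem sin_ne_zero_and_sin_eq_of_symm_about_odd_mul_pi_div_two {n : ℕ} (hn : Odd n) {x : ℝ}
    (hx : |x| < Real.pi / 2) :
    Real.sin (n * Real.pi / 2 - x) ≠ 0 ∧
      Real.sin (n * Real.pi / 2 + x) = Real.sin (n * Real.pi / 2 - x) := by
  obtain ⟨k, rfl⟩ := hn
  have h_sin (y : ℝ) :
      Real.sin (((2 * k + 1 : ℕ) : ℝ) * Real.pi / 2 + y) = (-1) ^ k * Real.cos y := by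
    rw [← Real.sin_add_pi_div_two, ← Real.sin_add_nat_mul_pi]
    congr 1
    push_cast
    ring
  rw [sub_eq_add_neg, h_sin, h_sin, Real.cos_neg]
  have h_cos := Real.cos_pos_of_mem_Ioo ⟨(abs_lt.mp hx).1.trans_eq' (by ring), (abs_lt.mp hx).2⟩
  exact ⟨mul_ne_zero (pow_ne_zero _ (by norm_num)) h_cos.ne', rfl⟩

/-- Case 1 (n odd): the boundary value p = 2 is allowed.  For θ = nπ/m with n odd,
n, m coprime, n < m: if m = 2M+1 is odd then sin(Mθ) ≠ 0, sin((M+1)θ) = sin(Mθ) and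
1 + sin((M+1)θ)/sin(Mθ) = 2; if m = 2(M+1) is even then sin((M+1/2)θ) ≠ 0,
sin((M+3/2)θ) = sin((M+1/2)θ) and 1 + sin((M+3/2)θ)/sin((M+1/2)θ) = 2. -/
theorem potts_case1_p_eq_two_allowed (n m : ℕ) (hcop : Nat.Coprime n m)
    (hno : Odd n) (hnm : n < m) (θ : ℝ) (hθ : θ = n * Real.pi / m) :
    (∀ M : ℕ, m = 2 * M + 1 →
      Real.sin ((M : ℝ) * θ) ≠ 0 ∧
      Real.sin (((M : ℝ) + 1) * θ) = Real.sin ((M : ℝ) * θ) ∧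
      1 + Real.sin (((M : ℝ) + 1) * θ) / Real.sin ((M : ℝ) * θ) = 2) ∧
    (∀ M : ℕ, m = 2 * (M + 1) →
      Real.sin (((M : ℝ) + 1/2) * θ) ≠ 0 ∧
      Real.sin (((M : ℝ) + 3/2) * θ) = Real.sin (((M : ℝ) + 1/2) * θ) ∧
      1 + Real.sin (((M : ℝ) + 3/2) * θ) / Real.sin (((M : ℝ) + 1/2) * θ) = 2) := by
  have hm : (0 : ℝ) < m := by exact_mod_cast (Nat.zero_le n).trans_lt hnm
  have h_half : |θ / 2| < Real.pi / 2 := by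
    have h_nonneg : 0 ≤ θ := by rw [hθ]; positivity
    have h_lt : θ < Real.pi := by
      rw [hθ, div_lt_iff₀ hm, mul_comm]
      gcongr
    rw [abs_of_nonneg (by positivity)]
    linarith
  have h_mul : (m : ℝ) * θ = n * Real.pi := by rw [hθ]; field_simp
  obtain ⟨h_ne, h_eq⟩ := sin_ne_zero_and_sin_eq_of_symm_about_odd_mul_pi_div_two hno h_half
  rw [← h_mul] at h_ne h_eq
  have key {a b : ℝ} (ha : a = m * θ / 2 - θ / 2) (hb : b = m * θ / 2 + θ / 2) :
      Real.sin a ≠ 0 ∧ Real.sin b = Real.sin a ∧ 1 + Real.sin b / Real.sin a = 2 := by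
    subst ha hb
    exact ⟨h_ne, h_eq, by rw [h_eq, div_self h_ne]; norm_num⟩
  constructor <;> intro M hM <;> apply key <;> rw [hM] <;> push_cast <;> ring
end

section
/- Let θ = nπ/m where n is odd, n and m are coprime positive integers with n < m. If M and M' are integers with −1 ≤ M ≤ m−2 and −1 ≤ M' ≤ m−2 and cos((M+3/2)θ) = cos((M'+3/2)θ), then M = M'. Consequently, in Case 1 the coefficients α_{2M+1} of z in the sheet expressions of the G-function are pairwise distinct for distinct M in this range. -/
/-- Case 1 (n odd): for θ = nπ/m with n, m coprime, n < m, the values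
cos((M+3/2)θ) are pairwise distinct for integers M in the range −1 ≤ M ≤ m−2;
hence the coefficients α_{2M+1} of z in the sheet expressions of the G-function
are pairwise distinct in this range. -/
theorem potts_case1_alpha_injective (n m : ℕ) (hcop : Nat.Coprime n m)
    (hno : Odd n) (hnm : n < m) (θ : ℝ) (hθ : θ = n * Real.pi / m)
    (M M' : ℤ) (hM1 : -1 ≤ M) (hM2 : M ≤ (m : ℤ) - 2)
    (hM'1 : -1 ≤ M') (hM'2 : M' ≤ (m : ℤ) - 2)
    (hcos : Real.cos (((M : ℝ) + 3/2) * θ) = Real.cos (((M' : ℝ) + 3/2) * θ)) :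
    M = M' := by
  have hm : (m : ℝ) ≠ 0 := by exact_mod_cast (by omega : m ≠ 0)
  have hco : IsCoprime (m : ℤ) (n : ℤ) := Nat.isCoprime_iff_coprime.2 hcop.symm
  obtain ⟨k, hk | hk⟩ := Real.cos_eq_cos_iff.1 hcos
  · have key : (n : ℤ) * (M' - M) = m * (2 * k) := by
      have h : (n : ℝ) * (M' - M) = m * (2 * k) := by
        apply mul_right_cancel₀ Real.pi_ne_zero
        rw [hθ] at hk
        field_simp at hk
        linear_combination hk / 2 * Real.pi
      exact_mod_cast h
    have hdvd : (m : ℤ) ∣ M' - M := hco.dvd_of_dvd_mul_left ⟨_, key⟩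
    have := Int.eq_zero_of_abs_lt_dvd hdvd (by rw [abs_lt]; omega)
    omega
  · have key : (n : ℤ) * (M + M' + 3) = m * (2 * k) := by
      have h : (n : ℝ) * (M + M' + 3) = m * (2 * k) := by
        apply mul_right_cancel₀ Real.pi_ne_zero
        rw [hθ] at hk
        field_simp at hk
        linear_combination hk / 2 * Real.pi
      exact_mod_cast h
    have hdvd : (m : ℤ) ∣ M + M' + 3 := hco.dvd_of_dvd_mul_left ⟨_, key⟩
    have hsum : M + M' + 3 - m = 0 :=
      Int.eq_zero_of_abs_lt_dvd (hdvd.sub (dvd_refl _)) (by rw [abs_lt]; omega)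
    rw [show M + M' + 3 = (m : ℤ) by omega, mul_comm] at key
    have hn := mul_left_cancel₀ (by omega : (m : ℤ) ≠ 0) key
    obtain ⟨j, hj⟩ := hno
    omega
end

section
/- Let θ = nπ/m where n is even, m ≥ 3 is odd, and n and m are coprime with n < m. If M and M' are integers with −1 ≤ M ≤ (m−3)/2 and −1 ≤ M' ≤ (m−3)/2 and cos((M+3/2)θ) = cos((M'+3/2)θ), then M = M'. Consequently, in Case 2 the coefficients α_{2M+1} of z in the sheet expressions of the G-function are pairwise distinct for distinct M in this range. -/
/-- Case 2 (n even, m odd ≥ 3): for θ = nπ/m with n, m coprime, n < m, the values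
cos((M+3/2)θ) are pairwise distinct for integers M in the range −1 ≤ M ≤ (m−3)/2;
hence the coefficients α_{2M+1} of z in the sheet expressions of the G-function
are pairwise distinct in this range. -/
theorem potts_case2_alpha_injective (n m : ℕ) (hcop : Nat.Coprime n m)
    (hne : Even n) (hn : 0 < n) (hmo : Odd m) (hm3 : 3 ≤ m) (hnm : n < m)
    (θ : ℝ) (hθ : θ = n * Real.pi / m)
    (M M' : ℤ) (hM1 : -1 ≤ M) (hM2 : 2 * M ≤ (m : ℤ) - 3)
    (hM'1 : -1 ≤ M') (hM'2 : 2 * M' ≤ (m : ℤ) - 3)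
    (hcos : Real.cos (((M : ℝ) + 3/2) * θ) = Real.cos (((M' : ℝ) + 3/2) * θ)) :
    M = M' := by
  have hm : (m : ℝ) ≠ 0 := by positivity
  have hmn : IsCoprime (m : ℤ) n := Nat.isCoprime_iff_coprime.2 hcop.symm
  have hm2 : IsCoprime (m : ℤ) 2 := by
    exact_mod_cast Nat.isCoprime_iff_coprime.2 hmo.coprime_two_right
  obtain ⟨k, hk | hk⟩ := Real.cos_eq_cos_iff.1 hcos
  · have key : (n : ℤ) * (2 * (M' - M)) = m * (4 * k) := by
      rw [hθ] at hk
      field_simp at hk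
      have : (n : ℝ) * (2 * (M' - M)) = m * (4 * k) := by linarith
      exact_mod_cast this
    have hdvd : (m : ℤ) ∣ M' - M :=
      hm2.dvd_of_dvd_mul_left (hmn.dvd_of_dvd_mul_left ⟨_, key⟩)
    have := Int.eq_zero_of_abs_lt_dvd hdvd (abs_lt.2 ⟨by omega, by omega⟩)
    omega
  · have key : (n : ℤ) * (2 * (M' + M + 3)) = m * (4 * k) := by
      rw [hθ] at hk
      field_simp at hk
      have : (n : ℝ) * (2 * (M' + M + 3)) = m * (4 * k) := by linarith
      exact_mod_cast this
    have hdvd : (m : ℤ) ∣ M' + M + 3 :=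
      hm2.dvd_of_dvd_mul_left (hmn.dvd_of_dvd_mul_left ⟨_, key⟩)
    have := Int.le_of_dvd (by omega) hdvd
    omega
end

section
/- Let β > 0 be real, set c = 1/(e^β + 1), μ = (1−c)/((1+c)(1−2c)), λ = √((1−c)/(1+c)), and let β̂ be defined by e^{β̂} = 1 + 3/(e^β − 1). Let ω ∈ ℂ satisfy ω² + ω + 1 = 0, and let M₁, M₂, M₃ be N×N complex matrices. Define X = (λ/√3)(M₁+M₂+M₃), U = (λ/√3)(M₁+ωM₂+ω²M₃), V = (λ/√3)(M₁+ω²M₂+ωM₃). Then (1/2)·Tr(X² + 2e^{β̂}·UV) = (μ/2)·Tr(M₁² + M₂² + M₃²) − μc·Tr(M₁M₂ + M₁M₃ + M₂M₃). -/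
open Matrix in
theorem trace_add_add_sq {n R : Type*} [Fintype n] [DecidableEq n] [CommRing R]
    (A B C : Matrix n n R) :
    trace ((A + B + C) ^ 2) =
      trace (A ^ 2 + B ^ 2 + C ^ 2) + 2 * trace (A * B + A * C + B * C) := by
  simp only [sq, add_mul, mul_add, trace_add]
  rw [trace_mul_comm B A, trace_mul_comm C A, trace_mul_comm C B]
  ring

/-- The trace of the product of the two nontrivial discrete Fourier modes of three matrices. -/
theorem trace_mul_fourier_three {n R : Type*} [Fintype n] [DecidableEq n] [CommRing R]
    {ω : R} (hω : ω ^ 2 + ω + 1 = 0) (A B C : Matrix n n R) :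
    Matrix.trace ((A + ω • B + ω ^ 2 • C) * (A + ω ^ 2 • B + ω • C)) =
      Matrix.trace (A ^ 2 + B ^ 2 + C ^ 2) - Matrix.trace (A * B + A * C + B * C) := by
  simp only [sq (_ : Matrix n n R), add_mul, mul_add, Matrix.trace_add, smul_mul_assoc,
    mul_smul_comm, Matrix.trace_smul, smul_eq_mul]
  rw [Matrix.trace_mul_comm B A, Matrix.trace_mul_comm C A, Matrix.trace_mul_comm C B]
  linear_combination (Matrix.trace (A * B) + Matrix.trace (A * C)
    + (ω ^ 2 - ω + 1) * Matrix.trace (B * C)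
    + (ω - 1) * (Matrix.trace (B * B) + Matrix.trace (C * C))) * hω

/-- Equality of the couplings in the original and dual quadratic actions, with `x = exp β`. -/
theorem potts_dual_couplings {x c μ k E : ℝ} (hx : 1 < x) (hc : c = 1 / (x + 1))
    (hμ : μ = (1 - c) / ((1 + c) * (1 - 2 * c))) (hk : k ^ 2 = (1 - c) / (1 + c) / 3)
    (hE : E = 1 + 3 / (x - 1)) :
    k ^ 2 * (1 + 2 * E) = μ ∧ k ^ 2 * (E - 1) = μ * c := by
  have h₁ : x - 1 ≠ 0 := by linarith
  have h₂ : x + 1 ≠ 0 := by linarith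
  have h₃ : x + 2 ≠ 0 := by linarith
  have hsub : 1 - c = x / (x + 1) := by rw [hc]; field_simp; ring
  have hadd : 1 + c = (x + 2) / (x + 1) := by rw [hc]; field_simp; ring
  have hsub₂ : 1 - 2 * c = (x - 1) / (x + 1) := by rw [hc]; field_simp; ring
  rw [hk, hμ, hsub, hadd, hsub₂, hc, hE]
  constructor <;> field_simp <;> ring

/-- 3-state Potts Kramers–Wannier duality of the quadratic part of the action:
with c = 1/(e^β+1), μ = (1−c)/((1+c)(1−2c)), λ = √((1−c)/(1+c)),
e^{β̂} = 1 + 3/(e^β−1), ω² + ω + 1 = 0, and X = (λ/√3)(M₁+M₂+M₃),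
U = (λ/√3)(M₁+ωM₂+ω²M₃), V = (λ/√3)(M₁+ω²M₂+ωM₃),
(1/2)Tr(X² + 2e^{β̂}UV) = (μ/2)Tr(M₁²+M₂²+M₃²) − μc·Tr(M₁M₂+M₁M₃+M₂M₃). -/
theorem potts_dual_quadratic_action (β : ℝ) (hβ : 0 < β) (c μ lam bhat : ℝ)
    (hc : c = 1 / (Real.exp β + 1))
    (hμ : μ = (1 - c) / ((1 + c) * (1 - 2 * c)))
    (hlam : lam = Real.sqrt ((1 - c) / (1 + c)))
    (hbhat : Real.exp bhat = 1 + 3 / (Real.exp β - 1))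
    (ω : ℂ) (hω : ω ^ 2 + ω + 1 = 0)
    (N : ℕ) (M₁ M₂ M₃ X U V : Matrix (Fin N) (Fin N) ℂ)
    (hX : X = ((lam / Real.sqrt 3 : ℝ) : ℂ) • (M₁ + M₂ + M₃))
    (hU : U = ((lam / Real.sqrt 3 : ℝ) : ℂ) • (M₁ + ω • M₂ + ω ^ 2 • M₃))
    (hV : V = ((lam / Real.sqrt 3 : ℝ) : ℂ) • (M₁ + ω ^ 2 • M₂ + ω • M₃)) :
    (1/2 : ℂ) * Matrix.trace (X ^ 2 + ((2 * Real.exp bhat : ℝ) : ℂ) • (U * V)) =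
      ((μ / 2 : ℝ) : ℂ) * Matrix.trace (M₁ ^ 2 + M₂ ^ 2 + M₃ ^ 2) -
        ((μ * c : ℝ) : ℂ) * Matrix.trace (M₁ * M₂ + M₁ * M₃ + M₂ * M₃) := by
  have hx : 1 < Real.exp β := Real.one_lt_exp_iff.mpr hβ
  have hc₀ : 0 < c := by rw [hc]; positivity
  have hc₁ : c ≤ 1 := by
    rw [hc, div_le_one (by positivity)]
    linarith
  have hk : (lam / Real.sqrt 3) ^ 2 = (1 - c) / (1 + c) / 3 := by
    rw [div_pow, hlam, Real.sq_sqrt (div_nonneg (by linarith) (by linarith)),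
      Real.sq_sqrt (by norm_num)]
  obtain ⟨hdiag, hoff⟩ := potts_dual_couplings hx hc hμ hk hbhat
  generalize lam / Real.sqrt 3 = k at *
  have hdiag' := congrArg (Complex.ofReal) hdiag
  have hoff' := congrArg (Complex.ofReal) hoff
  generalize Real.exp bhat = E at *
  push_cast at hdiag' hoff' ⊢
  rw [hX, hU, hV, smul_pow, smul_mul_smul_comm, Matrix.trace_add, Matrix.trace_smul,
    Matrix.trace_smul, Matrix.trace_smul, trace_add_add_sq, trace_mul_fourier_three hω]
  simp only [smul_eq_mul]
  linear_combination Matrix.trace (M₁ ^ 2 + M₂ ^ 2 + M₃ ^ 2) / 2 * hdiag'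
    - Matrix.trace (M₁ * M₂ + M₁ * M₃ + M₂ * M₃) * hoff'
end
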